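/- Let S be a nonzero Lie algebra over a field k and let L = S × S be the left Leibniz algebra with product (a,a')(b,b') = ([a,b],[a,b']). Then S₀ = S × {0} and S₁ = {(s,s) : s ∈ S} are two distinct subalgebras of L, each of which is a complement to the ideal K = {0} × S (i.e. S₀ + K = L, S₀ ∩ K = 0, S₁ + K = L, S₁ ∩ K = 0, and S₀ ≠ S₁). -/

import Mathlib

/-- The product of the split extension `L = S × S` of the left `S`-module `K = S`
(with zero right action) by the Lie algebra `S`: `(a,a')(b,b') = ([a,b],[a,b'])`. -/
def splitProd {S : Type*} [LieRing S] : S × S → S × S → S × S :=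
  fun x y => (⁅x.1, y.1⁆, ⁅x.1, y.2⁆)

/-- The subalgebra `S₀ = S × {0}` of the split extension `L = S × S`. -/
def factorSub (k S : Type*) [Field k] [LieRing S] [LieAlgebra k S] : Submodule k (S × S) :=
  (⊤ : Submodule k S).prod (⊥ : Submodule k S)

/-- The diagonal `S₁ = {(s,s)}` of the split extension `L = S × S`. -/
def diagSub (k S : Type*) [Field k] [LieRing S] [LieAlgebra k S] : Submodule k (S × S) :=
  LinearMap.range ((LinearMap.id : S →ₗ[k] S).prod LinearMap.id)

theorem mem_factorSub {k S : Type*} [Field k] [LieRing S] [LieAlgebra k S] {x : S × S} :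
    x ∈ factorSub k S ↔ x.2 = 0 := by
  simp [factorSub, Submodule.mem_prod]

theorem mem_diagSub {k S : Type*} [Field k] [LieRing S] [LieAlgebra k S] {x : S × S} :
    x ∈ diagSub k S ↔ x.1 = x.2 := by
  constructor
  · rintro ⟨s, rfl⟩
    rfl
  · intro h
    exact ⟨x.1, Prod.ext rfl h⟩

/-- For a nonzero Lie algebra `S`, both `S₀ = S × {0}` and the diagonal
`S₁ = {(s,s)}` are subalgebras of the split extension `L = S × S` complementing the
ideal `K = {0} × S`, and they are distinct. -/
theorem two_distinct_complements {k S : Type*} [Field k] [LieRing S] [LieAlgebra k S]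
    [Nontrivial S] :
    (∀ a ∈ factorSub k S, ∀ b ∈ factorSub k S, splitProd a b ∈ factorSub k S) ∧
    (∀ a ∈ diagSub k S, ∀ b ∈ diagSub k S, splitProd a b ∈ diagSub k S) ∧
    factorSub k S ⊔ (⊥ : Submodule k S).prod (⊤ : Submodule k S) = ⊤ ∧
    factorSub k S ⊓ (⊥ : Submodule k S).prod (⊤ : Submodule k S) = ⊥ ∧
    diagSub k S ⊔ (⊥ : Submodule k S).prod (⊤ : Submodule k S) = ⊤ ∧
    diagSub k S ⊓ (⊥ : Submodule k S).prod (⊤ : Submodule k S) = ⊥ ∧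
    factorSub k S ≠ diagSub k S := by
  refine ⟨fun a _ b hb => ?_, fun a _ b hb => ?_, ?_, ?_, ?_, ?_, fun h => ?_⟩
  · rw [mem_factorSub] at *
    simp [splitProd, hb]
  · rw [mem_diagSub] at *
    simp [splitProd, hb]
  · refine eq_top_iff.2 fun x _ => Submodule.mem_sup.2
      ⟨(x.1, 0), mem_factorSub.2 rfl, (0, x.2), ?_, by simp⟩
    simp [Submodule.mem_prod]
  · refine eq_bot_iff.2 fun x hx => ?_
    obtain ⟨h₀, hK⟩ := Submodule.mem_inf.1 hx
    exact Prod.ext hK.1 (mem_factorSub.1 h₀)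
  · refine eq_top_iff.2 fun x _ => Submodule.mem_sup.2
      ⟨(x.1, x.1), mem_diagSub.2 rfl, (0, x.2 - x.1), ?_, by simp⟩
    simp [Submodule.mem_prod]
  · refine eq_bot_iff.2 fun x hx => ?_
    obtain ⟨h₁, hK⟩ := Submodule.mem_inf.1 hx
    have hx₁ : x.1 = 0 := hK.1
    exact Prod.ext hx₁ ((mem_diagSub.1 h₁).symm.trans hx₁)
  · obtain ⟨s, hs⟩ := exists_ne (0 : S)
    have hd : (s, s) ∈ diagSub k S := mem_diagSub.2 rfl
    rw [← h, mem_factorSub] at hd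
    exact hs hd
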